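/- Let γ = z/n and ε > 0. With probability at least (1−γ)·(ε/(1+ε))^{k−1}, Algorithm 2 returns a set E of k vertices with φ_ε(X,E) ≤ 2·r_opt, i.e., a 2-approximation for (k,z)_ε-center clustering on X. -/

import Mathlib

set_option autoImplicit false

open Metric
open scoped ENNReal NNReal Classical

noncomputable def costSet {X : Type*} [MetricSpace X] (X' A : Finset X) : ℝ :=
  sSup ((fun p => Metric.infDist p (A : Set X)) '' (X' : Set X))

/-- `phi ε z A` is `φ_ε(X, A)`: the smallest clustering cost (radius) achievable with
center set `A` after excluding at most `(1+ε)z` outliers from `X`. -/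
noncomputable def phi {X : Type*} [MetricSpace X] [Fintype X] (ε : ℝ) (z : ℕ) (A : Finset X) : ℝ :=
  sInf {r : ℝ | ∃ X' : Finset X, (Fintype.card X : ℝ) - (1 + ε) * z ≤ X'.card ∧ r = costSet X' A}

/-- Algorithm 2: pick one uniform random vertex of `X`; in each subsequent round, let `F E`
be a set of the `(1+ε)z` vertices farthest from `E` and add one uniform random vertex of
`F E` to `E`.  `algorithm2 F hF j` is the distribution of `E` after `j + 1` picks. -/
noncomputable def algorithm2 {X : Type*} [MetricSpace X] [Fintype X] [DecidableEq X] [Nonempty X]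
    (F : Finset X → Finset X) (hF : ∀ E, (F E).Nonempty) : ℕ → PMF (Finset X)
  | 0 => (PMF.uniformOfFinset Finset.univ Finset.univ_nonempty).map (fun v => {v})
  | j + 1 => (algorithm2 F hF j).bind fun E =>
      (PMF.uniformOfFinset (F E) (hF E)).map (fun v => insert v E)

/-- `E` is nonempty and all but at most `(1+ε)z` points lie within distance `R` of `E`. -/
def CoversWithin {X : Type*} [MetricSpace X] [Fintype X] (ε : ℝ) (z : ℕ) (R : ℝ)
    (E : Finset X) : Prop :=
  E.Nonempty ∧ ∃ X' : Finset X, (Fintype.card X : ℝ) - (1 + ε) * z ≤ X'.card ∧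
    ∀ p ∈ X', infDist p (E : Set X) ≤ R

theorem CoversWithin.mono {X : Type*} [MetricSpace X] [Fintype X] {ε : ℝ} {z : ℕ} {R : ℝ}
    {E E' : Finset X} (h : CoversWithin ε z R E) (hE : E ⊆ E') : CoversWithin ε z R E' := by
  obtain ⟨hne, X', hcard, hX'⟩ := h
  exact ⟨hne.mono hE, X', hcard, fun p hp =>
    (infDist_le_infDist_of_subset (Finset.coe_subset.2 hE) (Finset.coe_nonempty.2 hne)).trans
      (hX' p hp)⟩

theorem CoversWithin.phi_le {X : Type*} [MetricSpace X] [Fintype X] {ε : ℝ} {z : ℕ} {R : ℝ}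
    {E : Finset X} (h : CoversWithin ε z R E) (hR : 0 ≤ R) : phi ε z E ≤ R := by
  obtain ⟨-, X', hcard, hX'⟩ := h
  have hbdd : BddBelow {r : ℝ | ∃ X' : Finset X,
      (Fintype.card X : ℝ) - (1 + ε) * z ≤ X'.card ∧ r = costSet X' E} := by
    refine ⟨0, ?_⟩
    rintro _ ⟨Y, -, rfl⟩
    refine Real.sSup_nonneg ?_
    rintro _ ⟨p, -, rfl⟩
    exact infDist_nonneg
  refine (csInf_le hbdd ⟨X', hcard, rfl⟩).trans (Real.sSup_le ?_ hR)
  rintro _ ⟨p, hp, rfl⟩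
  exact hX' p hp

/-- The indices of the clusters that meet `E`. -/
noncomputable def hitClusters {X ι : Type*} [Fintype ι] (C : ι → Finset X) (E : Finset X) :
    Finset ι :=
  Finset.univ.filter fun l => ∃ p ∈ C l, p ∈ E

theorem mem_hitClusters {X ι : Type*} [Fintype ι] {C : ι → Finset X} {E : Finset X} {l : ι} :
    l ∈ hitClusters C E ↔ ∃ p ∈ C l, p ∈ E := by
  simp [hitClusters]

theorem card_hitClusters_lt_insert {X ι : Type*} [Fintype ι] [DecidableEq X]
    {C : ι → Finset X} {E : Finset X} {l : ι} {v : X} (hv : v ∈ C l)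
    (hl : l ∉ hitClusters C E) :
    (hitClusters C E).card < (hitClusters C (insert v E)).card := by
  refine Finset.card_lt_card ((Finset.ssubset_iff_of_subset fun i hi => ?_).2 ⟨l, ?_, hl⟩)
  · obtain ⟨p, hp, hpE⟩ := mem_hitClusters.1 hi
    exact mem_hitClusters.2 ⟨p, hp, Finset.mem_insert_of_mem hpE⟩
  · exact mem_hitClusters.2 ⟨v, hv, Finset.mem_insert_self v E⟩

theorem infDist_le_two_mul_of_hit {X ι : Type*} [MetricSpace X] [Fintype ι]
    {C : ι → Finset X} {o : ι → X} {r : ℝ} (hcover : ∀ l, ∀ p ∈ C l, dist p (o l) ≤ r)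
    {E : Finset X} {l : ι} (hl : l ∈ hitClusters C E) {q : X} (hq : q ∈ C l) :
    infDist q (E : Set X) ≤ 2 * r := by
  obtain ⟨p, hp, hpE⟩ := mem_hitClusters.1 hl
  calc infDist q (E : Set X) ≤ dist q p := infDist_le_dist_of_mem (Finset.mem_coe.2 hpE)
    _ ≤ dist q (o l) + dist p (o l) := dist_triangle_right _ _ _
    _ ≤ 2 * r := by linarith [hcover l q hq, hcover l p hp]

theorem coversWithin_of_far {X : Type*} [MetricSpace X] [Fintype X] {ε : ℝ} {z : ℕ} {R : ℝ}
    {E Q : Finset X} (hE : E.Nonempty) (hQcard : (Q.card : ℝ) = (1 + ε) * z)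
    (hfar : ∀ p ∉ Q, ∀ q ∈ Q, infDist p (E : Set X) ≤ infDist q (E : Set X))
    {q : X} (hq : q ∈ Q) (hqR : infDist q (E : Set X) ≤ R) : CoversWithin ε z R E := by
  refine ⟨hE, Qᶜ, ?_, fun p hp => (hfar p (Finset.mem_compl.1 hp) q hq).trans hqR⟩
  have h : (Q.card : ℝ) + (Qᶜ.card : ℝ) = Fintype.card X := by
    exact_mod_cast Finset.card_add_card_compl Q
  linarith

theorem PMF.mul_le_toOuterMeasure_bind {α β : Type*} (p : PMF α) (f : α → PMF β)
    {s : Set α} {t : Set β} {a b : ℝ≥0∞} (hs : a ≤ p.toOuterMeasure s)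
    (ht : ∀ x ∈ s, b ≤ (f x).toOuterMeasure t) : a * b ≤ (p.bind f).toOuterMeasure t := by
  rw [PMF.toOuterMeasure_bind_apply]
  calc a * b ≤ p.toOuterMeasure s * b := by gcongr
    _ = ∑' x, s.indicator p x * b := by rw [PMF.toOuterMeasure_apply, ENNReal.tsum_mul_right]
    _ ≤ ∑' x, p x * (f x).toOuterMeasure t := ENNReal.tsum_le_tsum fun x => by
      by_cases hx : x ∈ s
      · rw [Set.indicator_of_mem hx]
        gcongr
        exact ht x hx
      · simp [Set.indicator_of_notMem hx]

theorem PMF.ofReal_le_toOuterMeasure_map_uniformOfFinset {α β : Type*} {Q : Finset α}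
    (hQ : Q.Nonempty) (f : α → β) {t : Set β} {G : Finset α} {c : ℝ} (hGQ : G ⊆ Q)
    (hG : ∀ x ∈ G, f x ∈ t) (hc : c * Q.card ≤ G.card) :
    ENNReal.ofReal c ≤ ((PMF.uniformOfFinset Q hQ).map f).toOuterMeasure t := by
  have hQpos : (0 : ℝ) < Q.card := by exact_mod_cast hQ.card_pos
  rw [PMF.toOuterMeasure_map_apply, PMF.toOuterMeasure_uniformOfFinset_apply]
  calc ENNReal.ofReal c ≤ ENNReal.ofReal ((G.card : ℝ) / Q.card) :=
        ENNReal.ofReal_le_ofReal ((le_div_iff₀ hQpos).2 hc)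
    _ = (G.card : ℝ≥0∞) / Q.card := by
        rw [ENNReal.ofReal_div_of_pos hQpos, ENNReal.ofReal_natCast, ENNReal.ofReal_natCast]
    _ ≤ _ := by
        gcongr
        exact fun x hx => Finset.mem_filter.2 ⟨hGQ hx, hG x hx⟩

/-- A far set of size `(1+ε)z` contains at least `εz` inliers, so either `E` already covers
within `2r`, or a uniform choice hits a new cluster with probability at least `ε/(1+ε)`. -/
theorem algorithm2_round_success {X ι : Type*} [MetricSpace X] [Fintype X] [DecidableEq X]
    [Fintype ι] {z : ℕ} {C : ι → Finset X} {o : ι → X} {r ε : ℝ} {Xopt : Finset X}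
    (hXoptcard : Xopt.card + z = Fintype.card X) (hmem : ∀ v ∈ Xopt, ∃ l, v ∈ C l)
    (hcover : ∀ l, ∀ p ∈ C l, dist p (o l) ≤ r) (hε : 0 < ε) {E Q : Finset X}
    (hQ : Q.Nonempty) (hQcard : (Q.card : ℝ) = (1 + ε) * z)
    (hfar : ∀ p ∉ Q, ∀ q ∈ Q, infDist p (E : Set X) ≤ infDist q (E : Set X)) {j : ℕ}
    (hE : CoversWithin ε z (2 * r) E ∨ j + 1 ≤ (hitClusters C E).card) :
    ENNReal.ofReal (ε / (1 + ε)) ≤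
      ((PMF.uniformOfFinset Q hQ).map fun v => insert v E).toOuterMeasure
        {E | CoversWithin ε z (2 * r) E ∨ j + 1 + 1 ≤ (hitClusters C E).card} := by
  by_cases hgood : CoversWithin ε z (2 * r) E
  · refine PMF.ofReal_le_toOuterMeasure_map_uniformOfFinset hQ _ subset_rfl
      (fun v _ => Or.inl (hgood.mono (Finset.subset_insert v E))) ?_
    refine mul_le_of_le_one_left (Nat.cast_nonneg _) ?_
    rw [div_le_one (by linarith)]
    linarith
  · have hhit := hE.resolve_left hgood
    have hEne : E.Nonempty := by
      obtain ⟨l, hl⟩ := Finset.card_pos.1 (Nat.lt_of_lt_of_le j.succ_pos hhit)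
      obtain ⟨p, -, hp⟩ := mem_hitClusters.1 hl
      exact ⟨p, hp⟩
    refine PMF.ofReal_le_toOuterMeasure_map_uniformOfFinset hQ _
      (Finset.inter_subset_left (s₂ := Xopt)) (fun v hv => Or.inr ?_) ?_
    · obtain ⟨hvQ, hvX⟩ := Finset.mem_inter.1 hv
      obtain ⟨l, hl⟩ := hmem v hvX
      exact hhit.trans_lt (card_hitClusters_lt_insert hl fun hlE => hgood
        (coversWithin_of_far hEne hQcard hfar hvQ (infDist_le_two_mul_of_hit hcover hlE hl)))
    · have h1 : Q.card ≤ (Q ∩ Xopt).card + z := by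
        have h2 := Finset.card_union_add_card_inter Q Xopt
        have h3 := Finset.card_le_univ (Q ∪ Xopt)
        omega
      have h1' : (Q.card : ℝ) ≤ (Q ∩ Xopt).card + z := by exact_mod_cast h1
      have h4 : ε / (1 + ε) * Q.card = ε * z := by
        rw [hQcard]
        field_simp
      linarith

theorem algorithm2_hit_or_covers {X ι : Type*} [MetricSpace X] [Fintype X] [DecidableEq X]
    [Nonempty X] [Fintype ι] {z : ℕ} {C : ι → Finset X} {o : ι → X} {r ε : ℝ}
    {Xopt : Finset X} (hXoptcard : Xopt.card + z = Fintype.card X)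
    (hmem : ∀ v ∈ Xopt, ∃ l, v ∈ C l) (hcover : ∀ l, ∀ p ∈ C l, dist p (o l) ≤ r)
    (hε : 0 < ε) (F : Finset X → Finset X) (hF : ∀ E, (F E).Nonempty)
    (hFcard : ∀ E, ((F E).card : ℝ) = (1 + ε) * z)
    (hFfar : ∀ E : Finset X, ∀ p ∉ F E, ∀ q ∈ F E,
      infDist p (E : Set X) ≤ infDist q (E : Set X)) (j : ℕ) :
    ENNReal.ofReal ((1 - (z : ℝ) / Fintype.card X) * (ε / (1 + ε)) ^ j) ≤
      (algorithm2 F hF j).toOuterMeasure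
        {E | CoversWithin ε z (2 * r) E ∨ j + 1 ≤ (hitClusters C E).card} := by
  induction j with
  | zero =>
    refine PMF.ofReal_le_toOuterMeasure_map_uniformOfFinset _ _ (Finset.subset_univ Xopt)
      (fun v hv => Or.inr ?_) ?_
    · obtain ⟨l, hl⟩ := hmem v hv
      exact Finset.card_pos.2 ⟨l, mem_hitClusters.2 ⟨v, hl, Finset.mem_singleton_self v⟩⟩
    · have hpos : (0 : ℝ) < Fintype.card X := by exact_mod_cast Fintype.card_pos
      have hcard : (Xopt.card : ℝ) + z = Fintype.card X := by exact_mod_cast hXoptcard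
      rw [pow_zero, mul_one, Finset.card_univ, sub_mul, div_mul_cancel₀ _ hpos.ne']
      linarith
  | succ j ih =>
    rw [pow_succ, ← mul_assoc, ENNReal.ofReal_mul' (by positivity)]
    exact PMF.mul_le_toOuterMeasure_bind _ _ ih fun E hE =>
      algorithm2_round_success hXoptcard hmem hcover hε (hF E) (hFcard E) (hFfar E) hE

theorem card_le_of_mem_support_algorithm2 {X : Type*} [MetricSpace X] [Fintype X]
    [DecidableEq X] [Nonempty X] (F : Finset X → Finset X) (hF : ∀ E, (F E).Nonempty) (j : ℕ) :
    ∀ E ∈ (algorithm2 F hF j).support, E.card ≤ j + 1 := by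
  induction j with
  | zero =>
    intro E hE
    obtain ⟨v, -, rfl⟩ := (PMF.mem_support_map_iff _ _ _).1 hE
    simp
  | succ j ih =>
    intro E hE
    obtain ⟨E', hE', hE⟩ := (PMF.mem_support_bind_iff _ _ _).1 hE
    obtain ⟨v, -, rfl⟩ := (PMF.mem_support_map_iff _ _ _).1 hE
    exact (Finset.card_insert_le _ _).trans (Nat.succ_le_succ (ih E' hE'))

/-- If every cluster is hit, the inliers are covered, so the target is met. -/
theorem coversWithin_of_hit_all {X ι : Type*} [MetricSpace X] [Fintype X] [Fintype ι]
    [Nonempty ι] {z : ℕ} {C : ι → Finset X} {o : ι → X} {r ε : ℝ} {Xopt : Finset X}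
    (hXoptcard : Xopt.card + z = Fintype.card X) (hmem : ∀ v ∈ Xopt, ∃ l, v ∈ C l)
    (hcover : ∀ l, ∀ p ∈ C l, dist p (o l) ≤ r) (hε : 0 ≤ ε) {E : Finset X}
    (hE : Fintype.card ι ≤ (hitClusters C E).card) : CoversWithin ε z (2 * r) E := by
  have hall : ∀ l, l ∈ hitClusters C E := fun l => by
    rw [(Finset.card_eq_iff_eq_univ _).1 (le_antisymm (Finset.card_le_univ _) hE)]
    exact Finset.mem_univ l
  obtain ⟨p, -, hp⟩ := mem_hitClusters.1 (hall (Classical.arbitrary ι))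
  refine ⟨⟨p, hp⟩, Xopt, ?_, fun q hq => ?_⟩
  · have hcard : (Xopt.card : ℝ) + z = Fintype.card X := by exact_mod_cast hXoptcard
    have : 0 ≤ ε * z := by positivity
    linarith
  · obtain ⟨l, hl⟩ := hmem q hq
    exact infDist_le_two_mul_of_hit hcover (hall l) hl

/-- Theorem 3: with probability at least `(1-γ)·(ε/(1+ε))^{k-1}` (where
`γ = z/n`), Algorithm 2 returns a set `E` of at most `k` vertices with
`φ_ε(X,E) ≤ 2·r_opt`, i.e. a 2-approximation for `(k,z)_ε`-center clustering. -/
theorem algorithm2_two_approx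
    {X : Type*} [MetricSpace X] [Fintype X] [DecidableEq X] [Nonempty X]
    (n k z : ℕ) (hn : Fintype.card X = n) (hz : 0 < z) (hzn : z < n) (hk : 1 ≤ k)
    (Xopt : Finset X) (C : Fin k → Finset X) (o : Fin k → X)
    (ropt : ℝ) (hropt0 : 0 ≤ ropt)
    (hXoptcard : Xopt.card = n - z)
    (hunion : Finset.univ.biUnion C = Xopt)
    (hdisj : ∀ i j : Fin k, i ≠ j → Disjoint (C i) (C j))
    (hcover : ∀ l : Fin k, ∀ p ∈ C l, dist p (o l) ≤ ropt)
    (hoptmin : ∀ A : Finset X, A.card = k → ropt ≤ phi 0 z A)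
    (ε : ℝ) (hε : 0 < ε)
    (F : Finset X → Finset X) (hF : ∀ E, (F E).Nonempty)
    (hFcard : ∀ E, ((F E).card : ℝ) = (1 + ε) * z)
    (hFfar : ∀ E : Finset X, ∀ p ∉ F E, ∀ q ∈ F E,
      infDist p (E : Set X) ≤ infDist q (E : Set X))
    :
    ENNReal.ofReal ((1 - (z : ℝ) / n) * (ε / (1 + ε)) ^ (k - 1)) ≤
      (algorithm2 F hF (k - 1)).toOuterMeasure {E : Finset X | phi ε z E ≤ 2 * ropt} ∧
    ∀ E ∈ (algorithm2 F hF (k - 1)).support, E.card ≤ k := by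
  obtain ⟨j, rfl⟩ : ∃ j, k = j + 1 := ⟨k - 1, by omega⟩
  subst hn
  have hcard : Xopt.card + z = Fintype.card X := by omega
  have hmem : ∀ v ∈ Xopt, ∃ l, v ∈ C l := fun v hv => by
    rw [← hunion] at hv
    obtain ⟨l, -, hl⟩ := Finset.mem_biUnion.1 hv
    exact ⟨l, hl⟩
  refine ⟨(algorithm2_hit_or_covers hcard hmem hcover hε F hF hFcard hFfar j).trans ?_,
    card_le_of_mem_support_algorithm2 F hF j⟩
  refine (algorithm2 F hF j).toOuterMeasure.mono fun E hE => ?_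
  have hE' : CoversWithin ε z (2 * ropt) E := hE.elim id fun h =>
    coversWithin_of_hit_all hcard hmem hcover hε.le (by simpa using h)
  exact hE'.phi_le (by linarith)
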